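/- Let S be an inverse semigroup and N a normal inverse subsemigroup of S. Suppose s, t ∈ S satisfy s⁻¹ s ≃_N t t⁻¹, and let a ∈ N satisfy a a⁻¹ ≤ s⁻¹ s and a⁻¹ a = t t⁻¹. Then (s a t)(s a t)⁻¹ ≃_N s s⁻¹ and (s a t)⁻¹ (s a t) ≃_N t⁻¹ t; that is, in the quotient groupoid S//N the class of s a t has domain the class of s s⁻¹ and range the class of t⁻¹ t. -/

import Mathlib

/-- An inverse semigroup: a semigroup in which every element `s` has a
(unique) inverse `s⁻¹` with `s * s⁻¹ * s = s` and `s⁻¹ * s * s⁻¹ = s⁻¹`. -/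
class InverseSemigroup (S : Type*) extends Semigroup S, Inv S where
  mul_inv_mul : ∀ s : S, s * s⁻¹ * s = s
  inv_mul_inv : ∀ s : S, s⁻¹ * s * s⁻¹ = s⁻¹
  inv_unique : ∀ s t : S, s * t * s = s → t * s * t = t → t = s⁻¹

/-- The natural partial order on an inverse semigroup:
`s ≤ t` iff `s = e * t` for some idempotent `e`. -/
def NatLe {S : Type*} [InverseSemigroup S] (s t : S) : Prop :=
  ∃ e : S, IsIdempotentElem e ∧ s = e * t

/-- A normal inverse subsemigroup: a full inverse subsemigroup that is
closed under conjugation. -/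
structure IsNormalInverseSubsemigroup {S : Type*} [InverseSemigroup S] (N : Set S) : Prop where
  mul_mem : ∀ {a b : S}, a ∈ N → b ∈ N → a * b ∈ N
  inv_mem : ∀ {a : S}, a ∈ N → a⁻¹ ∈ N
  full : ∀ {e : S}, IsIdempotentElem e → e ∈ N
  conj_mem : ∀ (s : S) {n : S}, n ∈ N → s⁻¹ * n * s ∈ N

/-- The preorder `≤_N` associated to a normal inverse subsemigroup `N`:
`s ≤_N t` iff there are `a, b ∈ N` with `a⁻¹ * a = s * s⁻¹`,
`s⁻¹ * s = b * b⁻¹` (so `a · s · b` is a trace product) and `a * s * b ≤ t`. -/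
def LeN {S : Type*} [InverseSemigroup S] (N : Set S) (s t : S) : Prop :=
  ∃ a ∈ N, ∃ b ∈ N, a⁻¹ * a = s * s⁻¹ ∧ s⁻¹ * s = b * b⁻¹ ∧ NatLe (a * s * b) t

/-- The equivalence `≃_N` obtained by symmetrizing `≤_N`. -/
def SimeqN {S : Type*} [InverseSemigroup S] (N : Set S) (s t : S) : Prop :=
  LeN N s t ∧ LeN N t s

namespace InverseSemigroup

variable {S : Type*} [InverseSemigroup S]

theorem inv_inv_eq (s : S) : s⁻¹⁻¹ = s :=
  (inv_unique _ _ (inv_mul_inv s) (mul_inv_mul s)).symm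

theorem inv_of_idem {e : S} (he : IsIdempotentElem e) : e⁻¹ = e :=
  (inv_unique e e (by rw [he.eq, he.eq]) (by rw [he.eq, he.eq])).symm

theorem idem_mul_inv (s : S) : IsIdempotentElem (s * s⁻¹) := by
  unfold IsIdempotentElem
  rw [← mul_assoc, mul_inv_mul]

theorem idem_inv_mul (s : S) : IsIdempotentElem (s⁻¹ * s) := by
  unfold IsIdempotentElem
  rw [← mul_assoc, inv_mul_inv]

theorem idem_mul {e f : S} (he : IsIdempotentElem e) (hf : IsIdempotentElem f) :
    IsIdempotentElem (e * f) := by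
  have e_mul : ∀ x, e * (e * x) = e * x := fun x => by rw [← mul_assoc, he.eq]
  have f_mul : ∀ x, f * (f * x) = f * x := fun x => by rw [← mul_assoc, hf.eq]
  have h₁ := mul_inv_mul (e * f)
  have h₂ := inv_mul_inv (e * f)
  have h₃ := inv_inv_eq (e * f)
  have huniq := inv_unique (e * f) (f * (e * f)⁻¹ * e)
  generalize (e * f)⁻¹ = x at h₁ h₂ h₃ huniq
  have hx : f * x * e = x := by
    apply huniq
    · simpa only [mul_assoc, e_mul, f_mul] using h₁
    · have := congrArg (fun y => f * y * e) h₂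
      simpa only [mul_assoc, e_mul, f_mul] using this
  have hxx : IsIdempotentElem x := by
    unfold IsIdempotentElem
    calc x * x = (f * x * e) * (f * x * e) := by rw [hx]
      _ = f * (x * (e * f) * x) * e := by simp only [mul_assoc]
      _ = x := by rw [h₂, hx]
  rw [← h₃, inv_of_idem hxx]
  exact hxx

theorem idem_comm {e f : S} (he : IsIdempotentElem e) (hf : IsIdempotentElem f) :
    e * f = f * e := by
  have key : ∀ {e f : S}, IsIdempotentElem e → IsIdempotentElem f →
      e * f * (f * e) * (e * f) = e * f := by
    intro e f he hf
    calc e * f * (f * e) * (e * f) = e * (f * f) * (e * e) * f := by simp only [mul_assoc]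
      _ = e * f * (e * f) := by rw [he.eq, hf.eq]; simp only [mul_assoc]
      _ = e * f := idem_mul he hf
  rw [inv_unique _ _ (key he hf) (key hf he), inv_of_idem (idem_mul he hf)]

theorem mul_inv_rev_eq (s t : S) : (s * t)⁻¹ = t⁻¹ * s⁻¹ := by
  have hc := idem_comm (idem_mul_inv t) (idem_inv_mul s)
  refine (inv_unique _ _ ?_ ?_).symm
  · calc s * t * (t⁻¹ * s⁻¹) * (s * t) = s * (t * t⁻¹ * (s⁻¹ * s)) * t := by
          simp only [mul_assoc]
      _ = s * s⁻¹ * s * (t * t⁻¹ * t) := by rw [hc]; simp only [mul_assoc]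
      _ = s * t := by rw [mul_inv_mul, mul_inv_mul]
  · calc t⁻¹ * s⁻¹ * (s * t) * (t⁻¹ * s⁻¹) = t⁻¹ * (s⁻¹ * s * (t * t⁻¹)) * s⁻¹ := by
          simp only [mul_assoc]
      _ = t⁻¹ * t * t⁻¹ * (s⁻¹ * s * s⁻¹) := by rw [← hc]; simp only [mul_assoc]
      _ = t⁻¹ * s⁻¹ := by rw [inv_mul_inv, inv_mul_inv]

theorem mul_eq_of_natLe {e f : S} (he : IsIdempotentElem e) (hf : IsIdempotentElem f)
    (h : NatLe e f) : f * e = e := by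
  obtain ⟨g, hg, rfl⟩ := h
  rw [idem_comm hf he, mul_assoc, hf.eq]

theorem leN_of_mem {N : Set S} (hN : IsNormalInverseSubsemigroup N) {e f d : S}
    (he : IsIdempotentElem e) (hd : d ∈ N) (hde : d⁻¹ * d = e) (hf : NatLe (d * d⁻¹) f) :
    LeN N e f := by
  refine ⟨d, hd, d⁻¹, hN.inv_mem hd, ?_, ?_, ?_⟩
  · rw [inv_of_idem he, he.eq, hde]
  · rw [inv_of_idem he, he.eq, inv_inv_eq, hde]
  · rwa [← hde, ← mul_assoc, mul_inv_mul]

theorem leN_of_natLe {N : Set S} (hN : IsNormalInverseSubsemigroup N) {e f : S}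
    (he : IsIdempotentElem e) (h : NatLe e f) : LeN N e f :=
  leN_of_mem hN he (hN.full he) (by rw [inv_of_idem he, he.eq])
    (by rwa [inv_of_idem he, he.eq])

theorem natLe_refl_of_idem {e : S} (he : IsIdempotentElem e) : NatLe e e :=
  ⟨e, he, he.eq.symm⟩

/-- If `e ≤_N f` for idempotents, then `e` is the domain of some `p ∈ N` whose range lies
below `f`. -/
theorem exists_mem_of_leN {N : Set S} {e f : S} (he : IsIdempotentElem e)
    (hf : IsIdempotentElem f) (h : LeN N e f) : ∃ p ∈ N, p⁻¹ * p = e ∧ f * p = p := by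
  obtain ⟨p, hp, b, -, hpe, hbe, g, hg, hpb⟩ := h
  rw [inv_of_idem he, he.eq] at hpe hbe
  have hpep : p * e = p := by rw [← hpe, ← mul_assoc, mul_inv_mul]
  rw [hpep] at hpb
  have hfpb : f * (p * b) = p * b := by
    rw [hpb, idem_comm hg hf, ← mul_assoc, hf.eq]
  refine ⟨p, hp, hpe, ?_⟩
  calc f * p = f * (p * b) * b⁻¹ := by rw [mul_assoc, mul_assoc, ← hbe, hpep]
    _ = p := by rw [hfpb, mul_assoc, ← hbe, hpep]

end InverseSemigroup

open InverseSemigroup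

/-- In the quotient groupoid `S//N`, the class of `s * a * t` has domain the
class of `s * s⁻¹` and range the class of `t⁻¹ * t`. -/
theorem simeqN_comp_domain_range {S : Type*} [InverseSemigroup S] {N : Set S}
    (hN : IsNormalInverseSubsemigroup N) {s t a : S}
    (h : SimeqN N (s⁻¹ * s) (t * t⁻¹))
    (ha : a ∈ N) (ha1 : NatLe (a * a⁻¹) (s⁻¹ * s)) (ha2 : a⁻¹ * a = t * t⁻¹) :
    SimeqN N ((s * a * t) * (s * a * t)⁻¹) (s * s⁻¹) ∧
      SimeqN N ((s * a * t)⁻¹ * (s * a * t)) (t⁻¹ * t) := by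
  have hsa : s⁻¹ * s * a = a := by
    have := mul_eq_of_natLe (idem_mul_inv a) (idem_inv_mul s) ha1
    calc s⁻¹ * s * a = s⁻¹ * s * (a * a⁻¹) * a := by rw [mul_assoc _ (a * a⁻¹), mul_inv_mul]
      _ = a := by rw [this, mul_inv_mul]
  have hdom : (s * a * t) * (s * a * t)⁻¹ = s * (a * a⁻¹) * s⁻¹ := by
    calc (s * a * t) * (s * a * t)⁻¹ = s * (a * (t * t⁻¹) * a⁻¹) * s⁻¹ := by
          simp only [mul_inv_rev_eq, mul_assoc]
      _ = s * (a * a⁻¹) * s⁻¹ := by rw [← ha2, ← mul_assoc a, mul_inv_mul]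
  have hran : (s * a * t)⁻¹ * (s * a * t) = t⁻¹ * t := by
    calc (s * a * t)⁻¹ * (s * a * t) = t⁻¹ * (a⁻¹ * (s⁻¹ * s * a)) * t := by
          simp only [mul_inv_rev_eq, mul_assoc]
      _ = t⁻¹ * t := by rw [hsa, ha2, ← mul_assoc t⁻¹, inv_mul_inv]
  refine ⟨⟨leN_of_natLe hN (idem_mul_inv _) ⟨_, idem_mul_inv (s * a * t), ?_⟩, ?_⟩, ?_⟩
  · rw [hdom]
    calc s * (a * a⁻¹) * s⁻¹ = s * (a * a⁻¹) * (s⁻¹ * s * s⁻¹) := by rw [inv_mul_inv]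
      _ = s * (a * a⁻¹) * s⁻¹ * (s * s⁻¹) := by simp only [mul_assoc]
  · obtain ⟨p, hp, hps, htp⟩ := exists_mem_of_leN (idem_inv_mul s) (idem_mul_inv t) h.1
    have hd : s * (a * p) * s⁻¹ ∈ N := by
      simpa only [inv_inv_eq] using hN.conj_mem s⁻¹ (hN.mul_mem ha hp)
    have hinv : (s * (a * p) * s⁻¹)⁻¹ = s * p⁻¹ * a⁻¹ * s⁻¹ := by
      simp only [mul_inv_rev_eq, inv_inv_eq, mul_assoc]
    refine leN_of_mem hN (idem_mul_inv s) hd ?_ ⟨_, idem_mul_inv (s * (a * p) * s⁻¹), ?_⟩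
    · calc (s * (a * p) * s⁻¹)⁻¹ * (s * (a * p) * s⁻¹)
          = s * p⁻¹ * (a⁻¹ * (s⁻¹ * s * a)) * p * s⁻¹ := by rw [hinv]; simp only [mul_assoc]
        _ = s * (p⁻¹ * (t * t⁻¹ * p)) * s⁻¹ := by rw [hsa, ha2]; simp only [mul_assoc]
        _ = s * s⁻¹ := by rw [htp, hps, ← mul_assoc s, mul_inv_mul]
    · rw [hdom, mul_assoc _ _ (s * (a * a⁻¹) * s⁻¹)]
      congr 1
      rw [hinv]
      calc s * p⁻¹ * a⁻¹ * s⁻¹ = s * p⁻¹ * (a⁻¹ * a * a⁻¹) * s⁻¹ := by rw [inv_mul_inv]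
        _ = s * p⁻¹ * (a⁻¹ * (s⁻¹ * s * a) * a⁻¹) * s⁻¹ := by rw [hsa]
        _ = s * p⁻¹ * a⁻¹ * s⁻¹ * (s * (a * a⁻¹) * s⁻¹) := by simp only [mul_assoc]
  · rw [hran]
    have := leN_of_natLe hN (idem_inv_mul t) (natLe_refl_of_idem (idem_inv_mul t))
    exact ⟨this, this⟩
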